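/- Let ‖·‖ be any operator norm on M_d(ℂ) induced by a norm on ℂ^d, S ⊂ M_d(ℂ) bounded, and n₁ = 2d². Then ‖S^{n₁}‖ ≤ 2⁷d⁴·ρ(S)·‖S‖^{n₁−1}. -/

import Mathlib

open scoped Pointwise
open Filter

/-- A norm on `ℂ^d`, given as a plain function with the norm axioms. -/
def IsCNorm {d : ℕ} (v : (Fin d → ℂ) → ℝ) : Prop :=
  (∀ x, 0 ≤ v x) ∧ (∀ x, v x = 0 ↔ x = 0) ∧
  (∀ (a : ℂ) (x), v (a • x) = ‖a‖ * v x) ∧ (∀ x y, v (x + y) ≤ v x + v y)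

/-- Operator norm on matrices induced by the norm `v` on `ℂ^d`. -/
noncomputable def opNorm {d : ℕ} (v : (Fin d → ℂ) → ℝ) (A : Matrix (Fin d) (Fin d) ℂ) : ℝ :=
  sSup {c : ℝ | ∃ x : Fin d → ℂ, v x ≤ 1 ∧ c = v (A.mulVec x)}

/-- Norm of a set of matrices: `sup_{s ∈ S} ‖s‖`. -/
noncomputable def setOpNorm {d : ℕ} (v : (Fin d → ℂ) → ℝ)
    (S : Set (Matrix (Fin d) (Fin d) ℂ)) : ℝ :=
  sSup (opNorm v '' S)

/-- The sup norm on `ℂ^d`, used as reference norm to define the joint spectral radius. -/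
noncomputable def stdNorm {d : ℕ} (x : Fin d → ℂ) : ℝ := ‖x‖

/-- The joint spectral radius `ρ(S) = inf_{n ≥ 1} ‖Sⁿ‖^{1/n}`. -/
noncomputable def jsr {d : ℕ} (S : Set (Matrix (Fin d) (Fin d) ℂ)) : ℝ :=
  ⨅ n : ℕ, setOpNorm stdNorm (S ^ (n + 1)) ^ (1 / (n + 1 : ℝ))

/-- The spectral radius of a matrix: the largest modulus of an eigenvalue. -/
noncomputable def specRad {d : ℕ} (A : Matrix (Fin d) (Fin d) ℂ) : ℝ :=
  sSup ((fun μ : ℂ => ‖μ‖) '' spectrum ℂ A)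

/-- `Λ(S) = sup_{s ∈ S} Λ(s)`. -/
noncomputable def lamSet {d : ℕ} (S : Set (Matrix (Fin d) (Fin d) ℂ)) : ℝ :=
  sSup (specRad '' S)

/-- Boundedness of a set of matrices. -/
def MatBdd {d : ℕ} (S : Set (Matrix (Fin d) (Fin d) ℂ)) : Prop :=
  ∃ C : ℝ, ∀ A ∈ S, ∀ i j, ‖A i j‖ ≤ C

/-- `S` is irreducible: it preserves no nonzero proper subspace of `ℂ^d`. -/
def IsIrred {d : ℕ} (S : Set (Matrix (Fin d) (Fin d) ℂ)) : Prop :=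
  ∀ W : Submodule ℂ (Fin d → ℂ), (∀ A ∈ S, ∀ x ∈ W, A.mulVec x ∈ W) → W = ⊥ ∨ W = ⊤


theorem stdNorm_isCNorm {d : ℕ} : IsCNorm (stdNorm : (Fin d → ℂ) → ℝ) := by
  refine ⟨fun x => norm_nonneg x, fun x => norm_eq_zero, fun a x => norm_smul a x,
    fun x y => norm_add_le x y⟩

theorem IsCNorm.zero {d : ℕ} {v : (Fin d → ℂ) → ℝ} (hv : IsCNorm v) : v 0 = 0 :=
  (hv.2.1 0).2 rfl

theorem IsCNorm.sum_le {d : ℕ} {v : (Fin d → ℂ) → ℝ} (hv : IsCNorm v) {ι : Type*}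
    (s : Finset ι) (f : ι → Fin d → ℂ) : v (∑ i ∈ s, f i) ≤ ∑ i ∈ s, v (f i) := by
  classical
  induction s using Finset.induction_on with
  | empty => simp [hv.zero]
  | insert a s ha ih =>
    rw [Finset.sum_insert ha, Finset.sum_insert ha]
    exact (hv.2.2.2 _ _).trans (by linarith)

theorem IsCNorm.upper {d : ℕ} {v : (Fin d → ℂ) → ℝ} (hv : IsCNorm v) :
    ∃ C : ℝ, 0 < C ∧ ∀ x, v x ≤ C * ‖x‖ := by
  refine ⟨∑ i, v (Pi.single i 1) + 1, ?_, fun x => ?_⟩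
  · have := Finset.sum_nonneg (s := Finset.univ)
      (fun (i : Fin d) _ => hv.1 (Pi.single i (1 : ℂ)))
    linarith
  · have hx : x = ∑ i, x i • (Pi.single i (1 : ℂ) : Fin d → ℂ) := by
      ext j
      simp [Finset.sum_apply, Pi.single_apply]
    have h1 : v x ≤ ∑ i, ‖x i‖ * v (Pi.single i 1) := by
      conv_lhs => rw [hx]
      refine (hv.sum_le _ _).trans (le_of_eq ?_)
      exact Finset.sum_congr rfl fun i _ => hv.2.2.1 _ _
    have h2 : ∑ i, ‖x i‖ * v (Pi.single i 1) ≤ ∑ i, ‖x‖ * v (Pi.single i 1) :=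
      Finset.sum_le_sum fun i _ => mul_le_mul_of_nonneg_right (norm_le_pi_norm x i) (hv.1 _)
    rw [← Finset.mul_sum] at h2
    nlinarith [norm_nonneg x]

theorem IsCNorm.neg {d : ℕ} {v : (Fin d → ℂ) → ℝ} (hv : IsCNorm v) (x) : v (-x) = v x := by
  have := hv.2.2.1 (-1) x
  simpa using this

theorem IsCNorm.continuous {d : ℕ} {v : (Fin d → ℂ) → ℝ} (hv : IsCNorm v) : Continuous v := by
  obtain ⟨C, hC, h⟩ := hv.upper
  have : LipschitzWith ⟨C, hC.le⟩ v := by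
    apply LipschitzWith.of_le_add_mul
    intro x y
    have := hv.2.2.2 y (x - y)
    rw [add_sub_cancel] at this
    rw [dist_eq_norm]
    exact this.trans (add_le_add le_rfl (h (x - y)))
  exact this.continuous

theorem IsCNorm.lower {d : ℕ} {v : (Fin d → ℂ) → ℝ} (hv : IsCNorm v) :
    ∃ c : ℝ, 0 < c ∧ ∀ x, c * ‖x‖ ≤ v x := by
  rcases (Metric.sphere (0 : Fin d → ℂ) 1).eq_empty_or_nonempty with he | hne
  · refine ⟨1, one_pos, fun x => ?_⟩
    have hx : x = 0 := by
      by_contra hx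
      have : ((‖x‖⁻¹ : ℝ) : ℂ) • x ∈ Metric.sphere (0 : Fin d → ℂ) 1 := by
        simp [norm_smul, hx]
      rw [he] at this
      exact this
    simp [hx, hv.zero]
  · obtain ⟨z, hz, hmin⟩ := (isCompact_sphere (0 : Fin d → ℂ) 1).exists_isMinOn hne
      hv.continuous.continuousOn
    have hz1 : ‖z‖ = 1 := by simpa using hz
    have hz0 : z ≠ 0 := by
      rintro rfl
      simp at hz1
    refine ⟨v z, lt_of_le_of_ne (hv.1 z) (fun h => hz0 ((hv.2.1 z).1 h.symm)), fun x => ?_⟩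
    by_cases hx : x = 0
    · simp [hx, hv.zero]
    · have hxn : 0 < ‖x‖ := norm_pos_iff.2 hx
      have hm : ((‖x‖⁻¹ : ℝ) : ℂ) • x ∈ Metric.sphere (0 : Fin d → ℂ) 1 := by
        simp [norm_smul, hx]
      have h := hmin hm
      simp only [Set.mem_ofPred_eq] at h
      rw [hv.2.2.1] at h
      simp only [Complex.norm_real, norm_inv, norm_norm] at h
      rw [inv_mul_eq_div, le_div_iff₀ hxn] at h
      exact h

theorem IsCNorm.auerbach {d : ℕ} {v : (Fin d → ℂ) → ℝ} (hv : IsCNorm v) :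
    ∃ P Q : Matrix (Fin d) (Fin d) ℂ, P * Q = 1 ∧ Q * P = 1 ∧
      (∀ x i, ‖(Q.mulVec x) i‖ ≤ v x) ∧ ∀ y, v (P.mulVec y) ≤ ∑ i, ‖y i‖ := by
  obtain ⟨c, hc, hlow⟩ := hv.lower
  obtain ⟨C, hC, hup⟩ := hv.upper
  let K : Set (Fin d → ℂ) := {x | v x ≤ 1}
  have hK : IsCompact K := by
    apply Metric.isCompact_of_isClosed_isBounded
    · exact isClosed_le hv.continuous continuous_const
    · rw [isBounded_iff_forall_norm_le]
      refine ⟨c⁻¹, fun x hx => ?_⟩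
      have h1 := hlow x
      have h2 : v x ≤ 1 := hx
      rw [← one_div, le_div_iff₀ hc]
      linarith
  let T : Set (Matrix (Fin d) (Fin d) ℂ) := Set.pi Set.univ (fun _ => K)
  have hT : IsCompact T := isCompact_univ_pi (fun _ => hK)
  have hmem : ((C⁻¹ : ℝ) : ℂ) • (1 : Matrix (Fin d) (Fin d) ℂ) ∈ T := by
    intro i _
    change v _ ≤ 1
    have h1 : (((C⁻¹ : ℝ) : ℂ) • (1 : Matrix (Fin d) (Fin d) ℂ)) i
        = ((C⁻¹ : ℝ) : ℂ) • (Pi.single i 1 : Fin d → ℂ) := by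
      ext j
      simp [Matrix.one_apply, Pi.single_apply, eq_comm]
    rw [h1, hv.2.2.1]
    have h2 := hup (Pi.single i 1 : Fin d → ℂ)
    rw [Pi.norm_single, norm_one, mul_one] at h2
    simp only [Complex.norm_real, norm_inv, Real.norm_eq_abs, abs_of_pos hC]
    rw [inv_mul_le_iff₀ hC]
    linarith
  have hcont : Continuous (fun X : Matrix (Fin d) (Fin d) ℂ => ‖X.det‖) :=
    (Continuous.matrix_det continuous_id).norm
  obtain ⟨X, hX, hmax⟩ := hT.exists_isMaxOn ⟨_, hmem⟩ hcont.continuousOn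
  have hdet : X.det ≠ 0 := by
    intro h0
    have := hmax hmem
    simp [h0, hC.ne'] at this
  have hdetn : 0 < ‖X.det‖ := norm_pos_iff.2 hdet
  have hu : IsUnit X.transpose.det := by rw [Matrix.det_transpose]; exact hdet.isUnit
  refine ⟨X.transpose, X.transpose⁻¹, Matrix.mul_nonsing_inv _ hu, Matrix.nonsing_inv_mul _ hu,
    fun x i => ?_, fun y => ?_⟩
  · have key : ∀ z, v z ≤ 1 → ‖(X.transpose⁻¹.mulVec z) i‖ ≤ 1 := by
      intro z hz
      have h1 : X.transpose⁻¹.mulVec z = (X.det)⁻¹ • X.transpose.cramer z := by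
        rw [← Matrix.det_transpose X]
        rw [Matrix.inv_def, Matrix.smul_mulVec, Matrix.cramer_eq_adjugate_mulVec,
          Ring.inverse_eq_inv']
      rw [h1, Pi.smul_apply, Matrix.cramer_apply, Matrix.updateCol_transpose,
        Matrix.det_transpose, norm_smul, norm_inv, inv_mul_le_iff₀ hdetn, mul_one]
      apply hmax
      intro j _
      by_cases hj : j = i
      · subst hj
        have h2 : X.updateRow j z j = z := Matrix.updateRow_self
        rw [h2]
        exact hz
      · rw [Matrix.updateRow_ne hj]
        exact hX j trivial
    by_cases hx : x = 0
    · simp [hx, hv.zero]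
    · have hpos : 0 < v x := lt_of_le_of_ne (hv.1 x) (fun h => hx ((hv.2.1 x).1 h.symm))
      have h := key (((v x)⁻¹ : ℝ) • x) (by
        have := hv.2.2.1 (((v x)⁻¹ : ℝ) : ℂ) x
        rw [Complex.coe_smul] at this
        rw [this]
        simp [abs_of_pos hpos, hpos.ne'])
      rw [Matrix.mulVec_smul, Pi.smul_apply, norm_smul, norm_inv, Real.norm_eq_abs,
        abs_of_pos hpos, inv_mul_le_iff₀ hpos, mul_one] at h
      exact h
  · have h1 : X.transpose.mulVec y = ∑ i, y i • X i := by
      ext j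
      simp [Matrix.mulVec, dotProduct, Finset.sum_apply, mul_comm]
    rw [h1]
    refine (hv.sum_le _ _).trans (Finset.sum_le_sum fun i _ => ?_)
    rw [hv.2.2.1]
    have : v (X i) ≤ 1 := hX i trivial
    exact mul_le_of_le_one_right (norm_nonneg _) this

/-- Euclidean norm. -/
noncomputable def ell2 {d : ℕ} (x : Fin d → ℂ) : ℝ := √(∑ i, ‖x i‖ ^ 2)

theorem ell2_nonneg {d : ℕ} (x : Fin d → ℂ) : 0 ≤ ell2 x := Real.sqrt_nonneg _

theorem ell2_sq {d : ℕ} (x : Fin d → ℂ) : ell2 x ^ 2 = ∑ i, ‖x i‖ ^ 2 :=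
  Real.sq_sqrt (Finset.sum_nonneg fun _ _ => sq_nonneg _)

theorem ell2_sq' {d : ℕ} (x : Fin d → ℂ) : ((ell2 x ^ 2 : ℝ) : ℂ) = star x ⬝ᵥ x := by
  rw [ell2_sq]
  simp [dotProduct, Complex.conj_mul']

theorem sum_le_ell2 {d : ℕ} (x : Fin d → ℂ) : ∑ i, ‖x i‖ ≤ √d * ell2 x := by
  refine (sq_le_sq₀ ?_ (mul_nonneg (Real.sqrt_nonneg _) (ell2_nonneg x))).1 ?_
  · exact Finset.sum_nonneg fun _ _ => norm_nonneg _
  rw [mul_pow, ell2_sq, Real.sq_sqrt (Nat.cast_nonneg d)]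
  have := sq_sum_le_card_mul_sum_sq (s := Finset.univ) (f := fun i => ‖x i‖)
  simpa using this

theorem ell2_le {d : ℕ} (x : Fin d → ℂ) (c : ℝ) (hc : 0 ≤ c) (h : ∀ i, ‖x i‖ ≤ c) :
    ell2 x ≤ √d * c := by
  refine (sq_le_sq₀ ?_ (mul_nonneg (Real.sqrt_nonneg _) hc)).1 ?_
  · exact ell2_nonneg x
  rw [mul_pow, ell2_sq, Real.sq_sqrt (Nat.cast_nonneg d)]
  calc ∑ i, ‖x i‖ ^ 2 ≤ ∑ i : Fin d, c ^ 2 :=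
        Finset.sum_le_sum fun i _ => pow_le_pow_left₀ (norm_nonneg _) (h i) 2
    _ = d * c ^ 2 := by simp

theorem ell2_cs {d : ℕ} (x y : Fin d → ℂ) : ‖star x ⬝ᵥ y‖ ≤ ell2 x * ell2 y := by
  have h1 : ‖star x ⬝ᵥ y‖ ≤ ∑ i, ‖x i‖ * ‖y i‖ := by
    refine (norm_sum_le _ _).trans (le_of_eq ?_)
    simp
  exact h1.trans (Real.sum_mul_le_sqrt_mul_sqrt _ _ _)

theorem ell2_mulVec_le {d : ℕ} (E : Matrix (Fin d) (Fin d) ℂ) (b : ℝ) (hb : 0 ≤ b)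
    (h : ∀ i j, ‖E i j‖ ≤ b) (y : Fin d → ℂ) : ell2 (E.mulVec y) ≤ d * b * ell2 y := by
  have h1 : ∀ i, ‖E.mulVec y i‖ ≤ b * (√d * ell2 y) := by
    intro i
    calc ‖E.mulVec y i‖ ≤ ∑ j, ‖E i j * y j‖ :=
          norm_sum_le Finset.univ (fun j => E i j * y j)
      _ ≤ ∑ j, b * ‖y j‖ := Finset.sum_le_sum fun j _ => by
          rw [norm_mul]; exact mul_le_mul_of_nonneg_right (h i j) (norm_nonneg _)
      _ = b * ∑ j, ‖y j‖ := by rw [Finset.mul_sum]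
      _ ≤ _ := mul_le_mul_of_nonneg_left (sum_le_ell2 y) hb
  refine (ell2_le _ _ (by have := ell2_nonneg y; positivity) h1).trans (le_of_eq ?_)
  have : √(d : ℝ) * √d = d := Real.mul_self_sqrt (Nat.cast_nonneg d)
  linear_combination (b * ell2 y) * this

theorem IsCNorm.hilb {d : ℕ} {v : (Fin d → ℂ) → ℝ} (hv : IsCNorm v) :
    ∃ P Q : Matrix (Fin d) (Fin d) ℂ, P * Q = 1 ∧ Q * P = 1 ∧
      (∀ x, ell2 (Q.mulVec x) ≤ √d * v x) ∧ ∀ y, v (P.mulVec y) ≤ √d * ell2 y := by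
  obtain ⟨P, Q, h1, h2, h3, h4⟩ := hv.auerbach
  exact ⟨P, Q, h1, h2, fun x => ell2_le _ _ (hv.1 x) (h3 x), fun y => (h4 y).trans (sum_le_ell2 y)⟩

theorem ell2_unitary {d : ℕ} (U : Matrix (Fin d) (Fin d) ℂ) (hU : U.conjTranspose * U = 1)
    (x : Fin d → ℂ) : ell2 (U.mulVec x) = ell2 x := by
  have h : ell2 (U.mulVec x) ^ 2 = ell2 x ^ 2 := by
    have : ((ell2 (U.mulVec x) ^ 2 : ℝ) : ℂ) = ((ell2 x ^ 2 : ℝ) : ℂ) := by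
      rw [ell2_sq', ell2_sq', Matrix.star_mulVec, ← Matrix.dotProduct_mulVec, Matrix.mulVec_mulVec,
        hU, Matrix.one_mulVec]
    exact_mod_cast this
  exact (pow_left_inj₀ (ell2_nonneg _) (ell2_nonneg _) two_ne_zero).1 h

theorem simul {d : ℕ} {v w : (Fin d → ℂ) → ℝ} (hv : IsCNorm v) (hw : IsCNorm w) :
    ∃ (W V : Matrix (Fin d) (Fin d) ℂ) (μ : Fin d → ℝ), W * V = 1 ∧ V * W = 1 ∧
      (∀ x, ell2 (V.mulVec x) ≤ √d * v x) ∧ (∀ y, v (W.mulVec y) ≤ √d * ell2 y) ∧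
      (∀ i, 0 < μ i) ∧
      ∀ (A : Matrix (Fin d) (Fin d) ℂ) (r : ℝ), 0 ≤ r → (∀ x, w (A.mulVec x) ≤ r * w x) →
        ∀ i j, ‖(V * A * W) i j‖ * μ i ≤ d * r * μ j := by
  obtain ⟨P, Q, hPQ, hQP, hQ, hP⟩ := hv.hilb
  obtain ⟨P', Q', hPQ', hQP', hQ', hP'⟩ := hw.hilb
  have hM : ((Q' * P).conjTranspose * (Q' * P)).IsHermitian :=
    Matrix.isHermitian_conjTranspose_mul_self _
  obtain ⟨U, D, hU1, hU2, hD⟩ : ∃ (U : Matrix (Fin d) (Fin d) ℂ) (D : Fin d → ℂ),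
      U.conjTranspose * U = 1 ∧ U * U.conjTranspose = 1 ∧
      U.conjTranspose * ((Q' * P).conjTranspose * (Q' * P)) * U = Matrix.diagonal D := by
    refine ⟨hM.eigenvectorUnitary, fun i => hM.eigenvalues i, ?_, ?_, ?_⟩
    · exact Unitary.coe_star_mul_self hM.eigenvectorUnitary
    · exact Unitary.coe_mul_star_self hM.eigenvectorUnitary
    · have := hM.conjStarAlgAut_star_eigenvectorUnitary
      rw [Unitary.conjStarAlgAut_star_apply] at this
      exact this
  have hVU : ∀ x, ell2 (U.conjTranspose.mulVec x) = ell2 x := fun x =>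
    ell2_unitary _ (by simpa using hU2) x
  set W := P * U with hW
  set V := U.conjTranspose * Q with hV
  have hWV : W * V = 1 := by
    rw [hW, hV]
    calc P * U * (U.conjTranspose * Q) = P * (U * U.conjTranspose) * Q := by
          simp only [Matrix.mul_assoc]
      _ = 1 := by rw [hU2, Matrix.mul_one, hPQ]
  have hVW : V * W = 1 := by
    rw [hW, hV]
    calc U.conjTranspose * Q * (P * U) = U.conjTranspose * (Q * P) * U := by
          simp only [Matrix.mul_assoc]
      _ = 1 := by rw [hQP, Matrix.mul_one, hU1]
  set R := Q' * W with hR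
  have hRR : R.conjTranspose * R = Matrix.diagonal D := by
    rw [← hD, hR, hW]
    simp only [Matrix.conjTranspose_mul, Matrix.mul_assoc]
  have hRinv : (V * P') * R = 1 := by
    rw [hR]
    calc V * P' * (Q' * W) = V * (P' * Q') * W := by simp only [Matrix.mul_assoc]
      _ = 1 := by rw [hPQ', Matrix.mul_one, hVW]
  have hcol : ∀ i, R.mulVec (Pi.single i 1) = fun k => R k i := by
    intro i
    ext k
    simp
  have hμD : ∀ i, ((ell2 (R.mulVec (Pi.single i 1)) ^ 2 : ℝ) : ℂ) = D i := by
    intro i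
    have h := congrFun (congrFun hRR i) i
    rw [Matrix.diagonal_apply_eq] at h
    rw [← h, ell2_sq', hcol, Matrix.mul_apply]
    simp [dotProduct]
  have hμ : ∀ i, 0 < ell2 (R.mulVec (Pi.single i 1)) := by
    intro i
    refine lt_of_le_of_ne (ell2_nonneg _) fun h0 => ?_
    have h1 : ∑ k, ‖R.mulVec (Pi.single i 1) k‖ ^ 2 = 0 := by rw [← ell2_sq, ← h0]; simp
    rw [Finset.sum_eq_zero_iff_of_nonneg (fun _ _ => sq_nonneg _)] at h1
    have h2 : R.mulVec (Pi.single i 1) = 0 := by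
      ext k
      simpa using h1 k (Finset.mem_univ k)
    have h3 : (Pi.single i 1 : Fin d → ℂ) = 0 := by
      rw [← Matrix.one_mulVec (Pi.single i 1 : Fin d → ℂ), ← hRinv, ← Matrix.mulVec_mulVec, h2,
        Matrix.mulVec_zero]
    have := congrFun h3 i
    simp at this
  refine ⟨W, V, fun i => ell2 (R.mulVec (Pi.single i 1)), hWV, hVW, fun x => ?_, fun y => ?_, hμ,
    fun A r hr hA i j => ?_⟩
  · rw [hV, ← Matrix.mulVec_mulVec, hVU]
    exact hQ x
  · rw [hW, ← Matrix.mulVec_mulVec]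
    refine (hP _).trans (le_of_eq ?_)
    rw [ell2_unitary U hU1]
  · set m := fun i => ell2 (R.mulVec (Pi.single i 1)) with hm
    have e1 : D i * (V * A * W) i j
        = star (R.mulVec (Pi.single i 1)) ⬝ᵥ (Q'.mulVec (A.mulVec (W.mulVec (Pi.single j 1)))) := by
      have : Matrix.diagonal D * (V * A * W) = R.conjTranspose * (Q' * (A * W)) := by
        rw [← hRR]
        calc R.conjTranspose * R * (V * A * W)
            = R.conjTranspose * (Q' * ((W * V) * (A * W))) := by
              rw [hR]; simp only [Matrix.mul_assoc]
          _ = _ := by rw [hWV, Matrix.one_mul]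
      have h := congrFun (congrFun this i) j
      rw [Matrix.diagonal_mul] at h
      rw [h, Matrix.mulVec_mulVec, Matrix.mulVec_mulVec, hcol, Matrix.mul_apply]
      simp [dotProduct, Matrix.mul_assoc]
    have e2 : m i ^ 2 * ‖(V * A * W) i j‖ ≤ m i * (√d * (r * (√d * m j))) := by
      have h1 : ‖D i‖ = m i ^ 2 := by
        rw [← hμD i, Complex.norm_real, Real.norm_eq_abs, abs_of_nonneg (sq_nonneg _)]
      rw [← h1, ← norm_mul, e1]
      refine (ell2_cs _ _).trans (mul_le_mul_of_nonneg_left ?_ (ell2_nonneg _))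
      refine (hQ' _).trans (mul_le_mul_of_nonneg_left ?_ (Real.sqrt_nonneg _))
      refine (hA _).trans (mul_le_mul_of_nonneg_left ?_ hr)
      refine le_trans (le_of_eq ?_) (hP' _)
      rw [Matrix.mulVec_mulVec, hR, ← Matrix.mul_assoc, hPQ', Matrix.one_mul]
    have e3 : √(d : ℝ) * √d = d := Real.mul_self_sqrt (Nat.cast_nonneg d)
    have e4 : m i * (‖(V * A * W) i j‖ * m i) ≤ m i * (d * r * m j) := by
      calc _ = m i ^ 2 * ‖(V * A * W) i j‖ := by ring
        _ ≤ _ := e2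
        _ = _ := by linear_combination (m i * r * m j) * e3
    exact le_of_mul_le_mul_left e4 (hμ i)

theorem pow_bound {d : ℕ} {v : (Fin d → ℂ) → ℝ}
    {S : Set (Matrix (Fin d) (Fin d) ℂ)} {M : ℝ} (hM : 0 ≤ M)
    (hSM : ∀ A ∈ S, ∀ x, v (A.mulVec x) ≤ M * v x) (k : ℕ) :
    ∀ p ∈ S ^ k, ∀ x, v (p.mulVec x) ≤ M ^ k * v x := by
  induction k with
  | zero =>
    intro p hp x
    rw [pow_zero, Set.mem_one] at hp
    simp [hp]
  | succ k ih =>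
    intro p hp x
    rw [pow_succ, Set.mem_mul] at hp
    obtain ⟨a, ha, b, hb, rfl⟩ := hp
    rw [← Matrix.mulVec_mulVec, pow_succ, mul_assoc]
    exact (ih a ha _).trans (mul_le_mul_of_nonneg_left (hSM b hb x) (pow_nonneg hM k))

theorem core {d : ℕ} (hd : 1 ≤ d) {v w : (Fin d → ℂ) → ℝ} (hv : IsCNorm v) (hw : IsCNorm w)
    {S : Set (Matrix (Fin d) (Fin d) ℂ)} {M r : ℝ} (hM : 0 ≤ M) (hr : 0 ≤ r)
    (hSM : ∀ A ∈ S, ∀ x, v (A.mulVec x) ≤ M * v x)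
    (hSr : ∀ A ∈ S, ∀ x, w (A.mulVec x) ≤ r * w x) :
    ∀ p ∈ S ^ d, ∀ x, v (p.mulVec x) ≤ 2 ^ 7 * d ^ 4 * r * M ^ (d - 1) * v x := by
  obtain ⟨W, V, μ, hWV, hVW, hV, hW, hμ, hent⟩ := simul hv hw
  set ε : ℝ := d ^ 3 * r with hε
  have hε0 : 0 ≤ ε := by positivity
  let rk : Fin d → ℕ := fun i => (Finset.univ.filter (fun k => μ k < μ i)).card
  have hrk : ∀ i j, μ i < μ j → rk i + 1 ≤ rk j := by
    intro i j hij
    apply Finset.card_lt_card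
    rw [Finset.ssubset_iff_of_subset]
    · exact ⟨i, by simpa using hij, by simp⟩
    · intro k hk
      simp only [Finset.mem_filter, Finset.mem_univ, true_and] at hk ⊢
      exact hk.trans hij
  have hrkd : ∀ i, rk i < d := by
    intro i
    have : rk i < (Finset.univ : Finset (Fin d)).card := by
      apply Finset.card_lt_card
      rw [Finset.ssubset_iff_of_subset (Finset.subset_univ _)]
      exact ⟨i, Finset.mem_univ _, by simp⟩
    simpa using this
  have split : ∀ A ∈ S, ∃ L : Matrix (Fin d) (Fin d) ℂ, (∀ i j, L i j ≠ 0 → rk i + 1 ≤ rk j) ∧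
      ∀ x, v ((A - W * L * V).mulVec x) ≤ ε * v x := by
    intro A hA
    let L : Matrix (Fin d) (Fin d) ℂ :=
      Matrix.of fun i j => if μ i < μ j then (V * A * W) i j else 0
    refine ⟨L, fun i j hij => ?_, fun x => ?_⟩
    · apply hrk
      by_contra h
      exact hij (by simp [L, h])
    · have hE : ∀ i j, ‖(V * A * W - L) i j‖ ≤ d * r := by
        intro i j
        by_cases h : μ i < μ j
        · simp only [Matrix.sub_apply, L, Matrix.of_apply, h, if_true, sub_self, norm_zero]
          positivity
        · simp only [Matrix.sub_apply, L, Matrix.of_apply, h, if_false, sub_zero]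
          have h1 := hent A r hr (hSr A hA) i j
          have h2 : (d : ℝ) * r * μ j ≤ d * r * μ i :=
            mul_le_mul_of_nonneg_left (not_lt.1 h) (by positivity)
          exact le_of_mul_le_mul_right (h1.trans h2) (hμ i)
      have e1 : A - W * L * V = W * (V * A * W - L) * V := by
        rw [Matrix.mul_sub, Matrix.sub_mul]
        congr 1
        calc A = (W * V) * A * (W * V) := by rw [hWV, Matrix.one_mul, Matrix.mul_one]
          _ = _ := by simp only [Matrix.mul_assoc]
      have hs := Real.sqrt_nonneg (d : ℝ)
      rw [e1, ← Matrix.mulVec_mulVec, ← Matrix.mulVec_mulVec]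
      calc _ ≤ √d * ell2 ((V * A * W - L).mulVec (V.mulVec x)) := hW _
        _ ≤ √d * (d * (d * r) * ell2 (V.mulVec x)) :=
          mul_le_mul_of_nonneg_left (ell2_mulVec_le _ _ (by positivity) hE _) hs
        _ ≤ √d * (d * (d * r) * (√d * v x)) :=
          mul_le_mul_of_nonneg_left (mul_le_mul_of_nonneg_left (hV x) (by positivity)) hs
        _ = ε * v x := by
          have e3 : √(d : ℝ) * √d = d := Real.mul_self_sqrt (Nat.cast_nonneg d)
          rw [hε]
          linear_combination (d * (d * r) * v x) * e3
  have main : ∀ k : ℕ, ∀ p ∈ S ^ k, ∃ L : Matrix (Fin d) (Fin d) ℂ,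
      (∀ i j, L i j ≠ 0 → rk i + k ≤ rk j) ∧
      ∀ x, v ((p - W * L * V).mulVec x) ≤ k * ε * (M + ε) ^ (k - 1) * v x := by
    intro k
    induction k with
    | zero =>
      intro p hp
      rw [pow_zero, Set.mem_one] at hp
      refine ⟨1, fun i j hij => ?_, fun x => ?_⟩
      · have : i = j := by
          by_contra h
          exact hij (Matrix.one_apply_ne h)
        simp [this]
      · simp [hp, hWV, hv.zero]
    | succ k ih =>
      intro p hp
      have hp' := hp
      rw [pow_succ, Set.mem_mul] at hp
      obtain ⟨a, ha, b, hb, rfl⟩ := hp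
      obtain ⟨L, hL, hLb⟩ := ih a ha
      obtain ⟨L', hL', hLb'⟩ := split b hb
      refine ⟨L * L', fun i j hij => ?_, fun x => ?_⟩
      · rw [Matrix.mul_apply] at hij
        obtain ⟨l, -, hl⟩ := Finset.exists_ne_zero_of_sum_ne_zero hij
        have h1 := hL i l (left_ne_zero_of_mul hl)
        have h2 := hL' l j (right_ne_zero_of_mul hl)
        omega
      · have e1 : a * b - W * (L * L') * V
            = a * (b - W * L' * V) + (a - W * L * V) * (W * L' * V) := by
          have : W * L * V * (W * L' * V) = W * (L * L') * V := by
            calc W * L * V * (W * L' * V) = W * L * ((V * W) * (L' * V)) := by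
                  simp only [Matrix.mul_assoc]
              _ = _ := by rw [hVW, Matrix.one_mul]; simp only [Matrix.mul_assoc]
          rw [Matrix.mul_sub, Matrix.sub_mul, this]
          abel
        have e2 : v ((W * L' * V).mulVec x) ≤ (M + ε) * v x := by
          have : (W * L' * V).mulVec x = b.mulVec x + -((b - W * L' * V).mulVec x) := by
            rw [Matrix.sub_mulVec]; abel
          rw [this]
          refine (hv.2.2.2 _ _).trans ?_
          rw [hv.neg, add_mul]
          exact add_le_add (hSM b hb x) (hLb' x)
        rw [e1, Matrix.add_mulVec, ← Matrix.mulVec_mulVec, ← Matrix.mulVec_mulVec]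
        refine (hv.2.2.2 _ _).trans ?_
        have e3 : v (a.mulVec ((b - W * L' * V).mulVec x)) ≤ (M + ε) ^ k * (ε * v x) := by
          refine (pow_bound hM hSM k a ha _).trans ?_
          have h1 : M ^ k ≤ (M + ε) ^ k := pow_le_pow_left₀ hM (by linarith) k
          exact mul_le_mul h1 (hLb' x) (hv.1 _) (by positivity)
        have e4 : v ((a - W * L * V).mulVec ((W * L' * V).mulVec x)) ≤
            k * ε * (M + ε) ^ (k - 1) * ((M + ε) * v x) :=
          (hLb _).trans (mul_le_mul_of_nonneg_left e2 (by positivity))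
        refine (add_le_add e3 e4).trans (le_of_eq ?_)
        cases k with
        | zero => simp
        | succ k =>
          simp only [Nat.add_sub_cancel]
          push_cast
          ring
  intro p hp x
  have hvx := hv.1 x
  have hd0 : (1 : ℝ) ≤ d := by exact_mod_cast hd
  by_cases hcase : M ≤ 2 ^ 7 * d ^ 4 * r
  · refine (pow_bound hM hSM d p hp x).trans (mul_le_mul_of_nonneg_right ?_ hvx)
    obtain ⟨n, rfl⟩ : ∃ n, d = n + 1 := ⟨d - 1, by omega⟩
    rw [Nat.add_sub_cancel, pow_succ M n, mul_comm]
    exact mul_le_mul_of_nonneg_right hcase (pow_nonneg hM _)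
  · push Not at hcase
    obtain ⟨L, hL, hLb⟩ := main d p hp
    have hL0 : L = 0 := by
      ext i j
      by_contra h
      have h1 := hL i j h
      have h2 := hrkd j
      omega
    have h := hLb x
    rw [hL0, Matrix.mul_zero, Matrix.zero_mul, sub_zero] at h
    refine h.trans (mul_le_mul_of_nonneg_right ?_ hvx)
    have hMpos : 0 < M := lt_of_le_of_lt (by positivity) hcase
    have h1 : M + ε ≤ M * Real.exp (1 / d) := by
      have h2 : (1 : ℝ) / d + 1 ≤ Real.exp (1 / d) := Real.add_one_le_exp _
      have h3 : ε ≤ M * (1 / d) := by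
        rw [mul_one_div, le_div_iff₀ (by linarith)]
        have : ε * d = d ^ 4 * r := by rw [hε]; ring
        rw [this]
        have : 0 ≤ (d : ℝ) ^ 4 * r := by positivity
        linarith
      nlinarith
    have h4 : (M + ε) ^ (d - 1) ≤ M ^ (d - 1) * 3 := by
      calc (M + ε) ^ (d - 1) ≤ (M * Real.exp (1 / d)) ^ (d - 1) :=
            pow_le_pow_left₀ (by positivity) h1 _
        _ = M ^ (d - 1) * Real.exp (1 / d) ^ (d - 1) := mul_pow _ _ _
        _ ≤ M ^ (d - 1) * 3 := by
          apply mul_le_mul_of_nonneg_left _ (by positivity)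
          calc Real.exp (1 / d) ^ (d - 1) ≤ Real.exp (1 / d) ^ d :=
                pow_le_pow_right₀ (Real.one_le_exp (by positivity)) (Nat.sub_le _ _)
            _ = Real.exp 1 := by
              rw [← Real.exp_nat_mul]
              congr 1
              field_simp
            _ ≤ 3 := by have := Real.exp_one_lt_d9; linarith
    calc d * ε * (M + ε) ^ (d - 1) ≤ d * ε * (M ^ (d - 1) * 3) :=
          mul_le_mul_of_nonneg_left h4 (by positivity)
      _ = 3 * (d ^ 4 * r * M ^ (d - 1)) := by rw [hε]; ring
      _ ≤ 2 ^ 7 * (d ^ 4 * r * M ^ (d - 1)) :=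
          mul_le_mul_of_nonneg_right (by norm_num) (by positivity)
      _ = _ := by ring

theorem MatBdd.bound {d : ℕ} {S : Set (Matrix (Fin d) (Fin d) ℂ)} (hS : MatBdd S)
    {v : (Fin d → ℂ) → ℝ} (hv : IsCNorm v) :
    ∃ K : ℝ, 0 ≤ K ∧ ∀ A ∈ S, ∀ x, v (A.mulVec x) ≤ K * v x := by
  obtain ⟨B, hB⟩ := hS
  obtain ⟨c, hc, hlow⟩ := hv.lower
  obtain ⟨C, hC, hup⟩ := hv.upper
  refine ⟨C * (d * |B|) * c⁻¹, by positivity, fun A hA x => ?_⟩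
  have h1 : ‖A.mulVec x‖ ≤ d * |B| * ‖x‖ := by
    refine (pi_norm_le_iff_of_nonneg (by positivity)).2 fun i => ?_
    calc ‖A.mulVec x i‖ ≤ ∑ j, ‖A i j * x j‖ :=
          norm_sum_le Finset.univ (fun j => A i j * x j)
      _ ≤ ∑ j : Fin d, |B| * ‖x‖ := Finset.sum_le_sum fun j _ => by
          rw [norm_mul]
          exact mul_le_mul ((hB A hA i j).trans (le_abs_self B)) (norm_le_pi_norm x j)
            (norm_nonneg _) (abs_nonneg _)
      _ = d * |B| * ‖x‖ := by simp [mul_assoc]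
  have h2 : ‖x‖ ≤ c⁻¹ * v x := by
    rw [le_inv_mul_iff₀ hc]
    exact hlow x
  calc v (A.mulVec x) ≤ C * ‖A.mulVec x‖ := hup _
    _ ≤ C * (d * |B| * (c⁻¹ * v x)) :=
      mul_le_mul_of_nonneg_left (h1.trans (mul_le_mul_of_nonneg_left h2 (by positivity))) hC.le
    _ = _ := by ring

theorem le_opNorm {d : ℕ} {v : (Fin d → ℂ) → ℝ} (hv : IsCNorm v)
    (A : Matrix (Fin d) (Fin d) ℂ) (K : ℝ) (hK : 0 ≤ K) (hA : ∀ x, v (A.mulVec x) ≤ K * v x)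
    (x : Fin d → ℂ) : v (A.mulVec x) ≤ opNorm v A * v x := by
  by_cases hx : x = 0
  · simp [hx, hv.zero]
  have hpos : 0 < v x := lt_of_le_of_ne (hv.1 x) (fun h => hx ((hv.2.1 x).1 h.symm))
  have hbdd : BddAbove {c : ℝ | ∃ x : Fin d → ℂ, v x ≤ 1 ∧ c = v (A.mulVec x)} := by
    refine ⟨K, ?_⟩
    rintro c ⟨y, hy, rfl⟩
    exact (hA y).trans (mul_le_of_le_one_right hK hy)
  have h := le_csSup hbdd (a := v (A.mulVec ((((v x)⁻¹ : ℝ) : ℂ) • x)))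
    ⟨_, by rw [hv.2.2.1]; simp [abs_of_pos hpos, hpos.ne'], rfl⟩
  rw [Matrix.mulVec_smul, hv.2.2.1, Complex.norm_real, Real.norm_eq_abs, abs_of_pos (inv_pos.2 hpos),
    inv_mul_le_iff₀ hpos] at h
  rw [mul_comm]
  exact h

theorem opNorm_le {d : ℕ} {v : (Fin d → ℂ) → ℝ} (hv : IsCNorm v)
    (A : Matrix (Fin d) (Fin d) ℂ) (K : ℝ) (hK : 0 ≤ K) (hA : ∀ x, v (A.mulVec x) ≤ K * v x) :
    opNorm v A ≤ K := by
  apply Real.sSup_le _ hK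
  rintro c ⟨y, hy, rfl⟩
  exact (hA y).trans (mul_le_of_le_one_right hK hy)

theorem opNorm_nonneg {d : ℕ} {v : (Fin d → ℂ) → ℝ} (hv : IsCNorm v)
    (A : Matrix (Fin d) (Fin d) ℂ) : 0 ≤ opNorm v A := by
  apply Real.sSup_nonneg
  rintro c ⟨y, hy, rfl⟩
  exact hv.1 _

theorem setOpNorm_nonneg {d : ℕ} {v : (Fin d → ℂ) → ℝ} (hv : IsCNorm v)
    (S : Set (Matrix (Fin d) (Fin d) ℂ)) : 0 ≤ setOpNorm v S := by
  apply Real.sSup_nonneg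
  rintro c ⟨y, hy, rfl⟩
  exact opNorm_nonneg hv _

theorem le_setOpNorm {d : ℕ} {v : (Fin d → ℂ) → ℝ} (hv : IsCNorm v)
    (S : Set (Matrix (Fin d) (Fin d) ℂ)) (K : ℝ) (hK : 0 ≤ K)
    (hS : ∀ A ∈ S, ∀ x, v (A.mulVec x) ≤ K * v x) :
    ∀ A ∈ S, ∀ x, v (A.mulVec x) ≤ setOpNorm v S * v x := by
  intro A hA x
  refine (le_opNorm hv A K hK (hS A hA) x).trans (mul_le_mul_of_nonneg_right ?_ (hv.1 x))
  apply le_csSup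
  · refine ⟨K, ?_⟩
    rintro c ⟨B, hB, rfl⟩
    exact opNorm_le hv B K hK (hS B hB)
  · exact ⟨A, hA, rfl⟩

/-- Extremal-type norm: if `S^N` has norm at most `r^N`, some norm contracts `S` by `r`. -/
theorem exists_norm {d : ℕ} {S : Set (Matrix (Fin d) (Fin d) ℂ)} {K r : ℝ} (hK : 0 ≤ K)
    (hr : 0 < r) (hSK : ∀ A ∈ S, ∀ x, ‖A.mulVec x‖ ≤ K * ‖x‖) (n : ℕ)
    (hN : ∀ p ∈ S ^ (n + 1), ∀ x, ‖p.mulVec x‖ ≤ r ^ (n + 1) * ‖x‖) :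
    ∃ w : (Fin d → ℂ) → ℝ, IsCNorm w ∧ ∀ A ∈ S, ∀ x, w (A.mulVec x) ≤ r * w x := by
  let F : (Fin d → ℂ) → Set ℝ :=
    fun x => {c | ∃ k ≤ n, ∃ p ∈ S ^ k, c = (r ^ k)⁻¹ * ‖p.mulVec x‖}
  have hbdd : ∀ x, BddAbove (F x) := by
    intro x
    refine ⟨∑ k ∈ Finset.range (n + 1), (r ^ k)⁻¹ * (K ^ k * ‖x‖), ?_⟩
    rintro c ⟨k, hk, p, hp, rfl⟩
    have h1 : (r ^ k)⁻¹ * ‖p.mulVec x‖ ≤ (r ^ k)⁻¹ * (K ^ k * ‖x‖) :=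
      mul_le_mul_of_nonneg_left (pow_bound (v := stdNorm) hK hSK k p hp x) (by positivity)
    refine h1.trans (Finset.single_le_sum (f := fun k => (r ^ k)⁻¹ * (K ^ k * ‖x‖))
      (fun _ _ => by positivity) (Finset.mem_range.2 (by omega)))
  have hself : ∀ x, ‖x‖ ∈ F x := fun x => ⟨0, Nat.zero_le _, 1, by simp, by simp⟩
  have hle : ∀ x, ‖x‖ ≤ sSup (F x) := fun x => le_csSup (hbdd x) (hself x)
  have h0 : ∀ x, 0 ≤ sSup (F x) := fun x => (norm_nonneg x).trans (hle x)
  have hsm : ∀ (a : ℂ) x, sSup (F (a • x)) ≤ ‖a‖ * sSup (F x) := by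
    intro a x
    apply csSup_le ⟨_, hself _⟩
    rintro c ⟨k, hk, p, hp, rfl⟩
    rw [Matrix.mulVec_smul, norm_smul, mul_left_comm]
    exact mul_le_mul_of_nonneg_left (le_csSup (hbdd x) ⟨k, hk, p, hp, rfl⟩) (norm_nonneg a)
  refine ⟨fun x => sSup (F x), ⟨h0, fun x => ⟨fun h => ?_, fun h => ?_⟩, fun a x => ?_,
    fun x y => ?_⟩, fun A hA x => ?_⟩
  · have h1 := hle x
    have h : sSup (F x) = 0 := h
    rw [h] at h1
    exact norm_le_zero_iff.1 h1
  · subst h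
    apply le_antisymm _ (h0 0)
    have := hsm 0 0
    simpa using this
  · apply le_antisymm (hsm a x)
    by_cases ha : a = 0
    · simpa [ha] using h0 0
    · have h1 := hsm a⁻¹ (a • x)
      rw [smul_smul, inv_mul_cancel₀ ha, one_smul, norm_inv,
        le_inv_mul_iff₀ (norm_pos_iff.2 ha)] at h1
      exact h1
  · apply csSup_le ⟨_, hself _⟩
    rintro c ⟨k, hk, p, hp, rfl⟩
    rw [Matrix.mulVec_add]
    have h1 := le_csSup (hbdd x) ⟨k, hk, p, hp, rfl⟩
    have h2 := le_csSup (hbdd y) ⟨k, hk, p, hp, rfl⟩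
    refine le_trans ?_ (add_le_add h1 h2)
    rw [← mul_add]
    exact mul_le_mul_of_nonneg_left (norm_add_le _ _) (by positivity)
  · apply csSup_le ⟨_, hself _⟩
    rintro c ⟨k, hk, p, hp, rfl⟩
    have hpA : p * A ∈ S ^ (k + 1) := by
      rw [pow_succ]
      exact Set.mul_mem_mul hp hA
    rw [Matrix.mulVec_mulVec]
    have e : (r ^ k)⁻¹ = r * (r ^ (k + 1))⁻¹ := by
      field_simp
      ring
    rw [e, mul_assoc]
    refine mul_le_mul_of_nonneg_left ?_ hr.le
    rcases Nat.lt_or_ge k n with hkn | hkn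
    · exact le_csSup (hbdd x) ⟨k + 1, hkn, _, hpA, rfl⟩
    · have hk' : k = n := le_antisymm hk hkn
      subst hk'
      refine le_trans ?_ (hle x)
      rw [inv_mul_le_iff₀ (by positivity)]
      exact hN _ hpA x

theorem jsr_nonneg {d : ℕ} (S : Set (Matrix (Fin d) (Fin d) ℂ)) : 0 ≤ jsr S :=
  Real.iInf_nonneg fun _ => Real.rpow_nonneg (setOpNorm_nonneg stdNorm_isCNorm _) _

/-- for any norm on `ℂ^d`, bounded `S` and `n₁ = 2d²`:
`‖S^{n₁}‖ ≤ 2⁷d⁴·ρ(S)·‖S‖^{n₁−1}`. -/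
theorem stmt_17 {d : ℕ} (v : (Fin d → ℂ) → ℝ) (hv : IsCNorm v)
    (S : Set (Matrix (Fin d) (Fin d) ℂ)) (hS : MatBdd S) :
    setOpNorm v (S ^ (2 * d ^ 2)) ≤
      2 ^ 7 * d ^ 4 * jsr S * setOpNorm v S ^ (2 * d ^ 2 - 1) := by
  obtain ⟨K₁, hK₁, hb₁⟩ := hS.bound hv
  obtain ⟨K₂, hK₂, hb₂⟩ := hS.bound stdNorm_isCNorm
  set M := setOpNorm v S with hMdef
  have hM : 0 ≤ M := setOpNorm_nonneg hv S
  have hSM := le_setOpNorm hv S K₁ hK₁ hb₁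
  have hρ := jsr_nonneg S
  have main : ∀ r, jsr S < r →
      setOpNorm v (S ^ (2 * d ^ 2)) ≤ 2 ^ 7 * d ^ 4 * r * M ^ (2 * d ^ 2 - 1) := by
    intro r hr
    have hr0 : 0 < r := hρ.trans_lt hr
    obtain ⟨n, hn⟩ := exists_lt_of_ciInf_lt hr
    have hs0 := setOpNorm_nonneg (stdNorm_isCNorm (d := d)) (S ^ (n + 1))
    have hn' : setOpNorm stdNorm (S ^ (n + 1)) ≤ r ^ (n + 1) := by
      have h1 := pow_le_pow_left₀ (Real.rpow_nonneg hs0 _) hn.le (n + 1)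
      rw [← Real.rpow_natCast, ← Real.rpow_mul hs0] at h1
      have h2 : (1 / ((n : ℝ) + 1)) * ((n + 1 : ℕ) : ℝ) = 1 := by
        push_cast
        field_simp
      rwa [h2, Real.rpow_one] at h1
    have hN : ∀ p ∈ S ^ (n + 1), ∀ x, ‖p.mulVec x‖ ≤ r ^ (n + 1) * ‖x‖ := by
      intro p hp x
      have h1 := le_setOpNorm stdNorm_isCNorm (S ^ (n + 1)) (K₂ ^ (n + 1)) (by positivity)
        (pow_bound hK₂ hb₂ (n + 1)) p hp x
      exact h1.trans (mul_le_mul_of_nonneg_right hn' (norm_nonneg x))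
    obtain ⟨w, hw, hSr⟩ := exists_norm hK₂ hr0 hb₂ n hN
    apply Real.sSup_le _ (by positivity)
    rintro c ⟨p, hp, rfl⟩
    apply opNorm_le hv p _ (by positivity)
    intro x
    rcases Nat.eq_zero_or_pos d with hd | hd
    · subst hd
      have : p.mulVec x = 0 := Subsingleton.elim _ _
      have hx : x = 0 := Subsingleton.elim _ _
      rw [this, hx, hv.zero]
      simp
    · have hsplit : 2 * d ^ 2 = d + (2 * d ^ 2 - d) := by
        have : d ≤ d ^ 2 := Nat.le_self_pow two_ne_zero d
        omega
      have hexp : 2 * d ^ 2 - 1 = (d - 1) + (2 * d ^ 2 - d) := by omega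
      rw [hsplit, pow_add, Set.mem_mul] at hp
      obtain ⟨a, ha, b, hb, rfl⟩ := hp
      rw [← Matrix.mulVec_mulVec, hexp, pow_add]
      calc _ ≤ 2 ^ 7 * d ^ 4 * r * M ^ (d - 1) * v (b.mulVec x) :=
            core hd hv hw hM hr0.le hSM hSr a ha _
        _ ≤ 2 ^ 7 * d ^ 4 * r * M ^ (d - 1) * (M ^ (2 * d ^ 2 - d) * v x) :=
            mul_le_mul_of_nonneg_left (pow_bound hM hSM _ b hb x) (by positivity)
        _ = _ := by ring
  have hcont : Continuous fun r : ℝ => 2 ^ 7 * (d : ℝ) ^ 4 * r * M ^ (2 * d ^ 2 - 1) := by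
    fun_prop
  have ht : Tendsto (fun r : ℝ => 2 ^ 7 * (d : ℝ) ^ 4 * r * M ^ (2 * d ^ 2 - 1))
      (nhdsWithin (jsr S) (Set.Ioi (jsr S)))
      (nhds (2 ^ 7 * (d : ℝ) ^ 4 * jsr S * M ^ (2 * d ^ 2 - 1))) :=
    (hcont.tendsto _).mono_left nhdsWithin_le_nhds
  exact ge_of_tendsto ht (Filter.eventually_of_mem self_mem_nhdsWithin main)
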